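/- arXiv:2605.02876 — 8 statements merged into one kernel-verified Lean document; each statement's English description precedes it below -/
import Mathlib

section
/- If a three-qubit density matrix ρ and unit vectors n1, n2 ∈ ℝ³ satisfy |I(n1,n2;ρ)| = 2, then n1 and n2 are orthogonal: n1·n2 = 0. -/
open Matrix Kronecker
open scoped ComplexOrder

noncomputable section

/-- Pauli matrices. -/
def σx : Matrix (Fin 2) (Fin 2) ℂ := !![0, 1; 1, 0]
def σy : Matrix (Fin 2) (Fin 2) ℂ := !![0, -Complex.I; Complex.I, 0]
def σz : Matrix (Fin 2) (Fin 2) ℂ := !![1, 0; 0, -1]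

/-- Spin observable along direction `n`. -/
def spin (n : Fin 3 → ℝ) : Matrix (Fin 2) (Fin 2) ℂ :=
  (n 0 : ℂ) • σx + (n 1 : ℂ) • σy + (n 2 : ℂ) • σz

/-- Index type for three qubits: `ℂ² ⊗ ℂ² ⊗ ℂ² ≅ ℂ⁸`. -/
abbrev Q3 := (Fin 2 × Fin 2) × Fin 2

/-- `n` is a unit vector in `ℝ³`. -/
def IsUnitVec (n : Fin 3 → ℝ) : Prop := n 0 ^ 2 + n 1 ^ 2 + n 2 ^ 2 = 1

/-- Euclidean dot product on `ℝ³`. -/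
def dot3 (a b : Fin 3 → ℝ) : ℝ := a 0 * b 0 + a 1 * b 1 + a 2 * b 2

def O1 (n1 n2 : Fin 3 → ℝ) : Matrix Q3 Q3 ℂ := spin n1 ⊗ₖ spin n2 ⊗ₖ spin n2
def O2 (n1 n2 : Fin 3 → ℝ) : Matrix Q3 Q3 ℂ := spin n2 ⊗ₖ spin n1 ⊗ₖ spin n2
def O3 (n1 n2 : Fin 3 → ℝ) : Matrix Q3 Q3 ℂ := spin n2 ⊗ₖ spin n2 ⊗ₖ spin n1
def O4 (n1 n2 : Fin 3 → ℝ) : Matrix Q3 Q3 ℂ := spin n1 ⊗ₖ spin n1 ⊗ₖ spin n1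

/-- The functional `I(n1,n2;ρ) = e₄ − e₁e₂e₃` with `eᵢ = Re Tr(Oᵢ ρ)`. -/
def Ifun (n1 n2 : Fin 3 → ℝ) (ρ : Matrix Q3 Q3 ℂ) : ℝ :=
  ((O4 n1 n2 * ρ).trace).re -
    ((O1 n1 n2 * ρ).trace).re * ((O2 n1 n2 * ρ).trace).re * ((O3 n1 n2 * ρ).trace).re

/-- Computational basis state `|ijk⟩` of three qubits. -/
def ket (i j k : Fin 2) : Q3 → ℂ := fun p => if p = ((i, j), k) then 1 else 0

/-- Expectation value `Re ⟨ψ, M ψ⟩` of an observable `M` in a pure state `ψ`. -/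
def eexp (M : Matrix Q3 Q3 ℂ) (ψ : Q3 → ℂ) : ℝ := (star ψ ⬝ᵥ M.mulVec ψ).re

/-- The functional `I` evaluated on a pure state `ρ = ψψ†`. -/
def Ipure (n1 n2 : Fin 3 → ℝ) (ψ : Q3 → ℂ) : ℝ :=
  eexp (O4 n1 n2) ψ - eexp (O1 n1 n2) ψ * eexp (O2 n1 n2) ψ * eexp (O3 n1 n2) ψ

theorem spin_isHermitian (n : Fin 3 → ℝ) : (spin n).IsHermitian := by
  ext i j
  fin_cases i <;> fin_cases j <;> simp [spin, σx, σy, σz]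

theorem spin_anticommutator (a b : Fin 3 → ℝ) :
    spin a * spin b + spin b * spin a = (2 * dot3 a b : ℂ) • 1 := by
  ext i j
  fin_cases i <;> fin_cases j <;>
    simp [spin, σx, σy, σz, dot3] <;> ring_nf <;> simp

theorem spin_mul_self {n : Fin 3 → ℝ} (hn : IsUnitVec n) : spin n * spin n = 1 := by
  have hd : dot3 n n = 1 := by rw [← hn, dot3]; ring
  have h := spin_anticommutator n n
  rw [hd, ← two_smul ℂ (spin n * spin n)] at h
  simpa using h

theorem spin_mul_spin_mul_spin {a b : Fin 3 → ℝ} (hb : IsUnitVec b) :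
    spin b * spin a * spin b = (2 * dot3 a b : ℂ) • spin b - spin a := by
  have h := congrArg (· * spin b) (spin_anticommutator a b)
  simp only [add_mul, Matrix.mul_assoc, spin_mul_self hb, Matrix.mul_one, Matrix.smul_mul,
    Matrix.one_mul] at h
  rw [← h, Matrix.mul_assoc]
  abel

theorem Matrix.IsHermitian.kronecker {m n : Type*} {A : Matrix m m ℂ} {B : Matrix n n ℂ}
    (hA : A.IsHermitian) (hB : B.IsHermitian) : (A ⊗ₖ B).IsHermitian := by
  rw [Matrix.IsHermitian, Matrix.conjTranspose_kronecker, hA.eq, hB.eq]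

theorem spin_kronecker_isHermitian (a b c : Fin 3 → ℝ) :
    (spin a ⊗ₖ spin b ⊗ₖ spin c).IsHermitian :=
  ((spin_isHermitian a).kronecker (spin_isHermitian b)).kronecker (spin_isHermitian c)

theorem spin_kronecker_mul_self {a b c : Fin 3 → ℝ} (ha : IsUnitVec a) (hb : IsUnitVec b)
    (hc : IsUnitVec c) :
    (spin a ⊗ₖ spin b ⊗ₖ spin c) * (spin a ⊗ₖ spin b ⊗ₖ spin c) = 1 := by
  simp only [← Matrix.mul_kronecker_mul, spin_mul_self, ha, hb, hc, Matrix.one_kronecker_one]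

section Involution

open scoped MatrixOrder Matrix.Norms.L2Operator

variable {n : Type*} [Fintype n] [DecidableEq n] {M ρ : Matrix n n ℂ}

theorem exists_trace_conjTranspose_mul_self_eq (hM : M.IsHermitian) (hM2 : M * M = 1)
    (hρ : ρ.PosSemidef) (htr : ρ.trace = 1) :
    ∃ D : Matrix n n ℂ, (Dᴴ * D).trace = 2 * (1 - (M * ρ).trace) ∧
      (D = 0 → M * ρ = ρ) := by
  obtain ⟨C, rfl⟩ := CStarAlgebra.nonneg_iff_eq_star_mul_self.mp hρ.nonneg
  have hP : (1 - M)ᴴ = 1 - M := by rw [conjTranspose_sub, conjTranspose_one, hM.eq]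
  rw [star_eq_conjTranspose] at htr ⊢
  refine ⟨C * (1 - M), ?_, fun h => ?_⟩
  · have hPP : (1 - M) * (1 - M) = (2 : ℂ) • (1 - M) := by
      rw [sub_mul, mul_sub, mul_sub, hM2, two_smul]
      simp only [Matrix.one_mul, Matrix.mul_one]
      abel
    rw [conjTranspose_mul, hP, ← Matrix.mul_assoc, Matrix.trace_mul_comm, Matrix.mul_assoc,
      ← Matrix.mul_assoc, hPP, Matrix.smul_mul, Matrix.trace_smul, sub_mul, Matrix.trace_sub,
      Matrix.one_mul, htr, smul_eq_mul]
  · have h' := congrArg (fun X => Xᴴ * C) h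
    simp only [conjTranspose_mul, hP, conjTranspose_zero, Matrix.zero_mul, sub_mul,
      Matrix.one_mul, Matrix.mul_assoc] at h'
    exact (sub_eq_zero.mp h').symm

theorem re_trace_mul_le_one (hM : M.IsHermitian) (hM2 : M * M = 1)
    (hρ : ρ.PosSemidef) (htr : ρ.trace = 1) : (M * ρ).trace.re ≤ 1 := by
  obtain ⟨D, hD, -⟩ := exists_trace_conjTranspose_mul_self_eq hM hM2 hρ htr
  have h := (Complex.le_def.mp (Matrix.posSemidef_conjTranspose_mul_self D).trace_nonneg).1
  rw [hD] at h
  simp at h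
  exact h

theorem mul_eq_self_of_re_trace_eq_one (hM : M.IsHermitian) (hM2 : M * M = 1)
    (hρ : ρ.PosSemidef) (htr : ρ.trace = 1) (h : (M * ρ).trace.re = 1) : M * ρ = ρ := by
  obtain ⟨D, hD, h0⟩ := exists_trace_conjTranspose_mul_self_eq hM hM2 hρ htr
  have him := (Complex.le_def.mp (Matrix.posSemidef_conjTranspose_mul_self D).trace_nonneg).2
  refine h0 (Matrix.trace_conjTranspose_mul_self_eq_zero_iff.mp (Complex.ext ?_ him.symm))
  rw [hD]
  simp [h]

theorem abs_re_trace_mul_le_one (hM : M.IsHermitian) (hM2 : M * M = 1)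
    (hρ : ρ.PosSemidef) (htr : ρ.trace = 1) : |(M * ρ).trace.re| ≤ 1 := by
  have h := re_trace_mul_le_one hM.neg (by simpa using hM2) hρ htr
  rw [Matrix.neg_mul, Matrix.trace_neg, Complex.neg_re] at h
  exact abs_le.mpr ⟨by linarith, re_trace_mul_le_one hM hM2 hρ htr⟩

theorem mul_eq_smul_of_abs_re_trace_eq_one (hM : M.IsHermitian) (hM2 : M * M = 1)
    (hρ : ρ.PosSemidef) (htr : ρ.trace = 1) (h : |(M * ρ).trace.re| = 1) :
    M * ρ = ((M * ρ).trace.re : ℂ) • ρ := by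
  rcases eq_or_eq_neg_of_abs_eq h with h | h
  · rw [h, mul_eq_self_of_re_trace_eq_one hM hM2 hρ htr h]
    simp
  · have h' := mul_eq_self_of_re_trace_eq_one hM.neg (by simpa using hM2) hρ htr
      (by rw [Matrix.neg_mul, Matrix.trace_neg, Complex.neg_re, h, neg_neg])
    rw [Matrix.neg_mul, neg_eq_iff_eq_neg] at h'
    simp [htr, h']

end Involution

theorem abs_eq_one_of_abs_sub_mul_eq_two {a b c d : ℝ} (ha : |a| ≤ 1) (hb : |b| ≤ 1)
    (hc : |c| ≤ 1) (hd : |d| ≤ 1) (h : |d - a * b * c| = 2) :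
    |a| = 1 ∧ |b| = 1 ∧ |c| = 1 ∧ |d| = 1 ∧ a * b * c = -d := by
  have hab : |a * b| ≤ 1 := by rw [abs_mul]; exact mul_le_one₀ ha (abs_nonneg b) hb
  have habc : |a * b * c| ≤ 1 := by rw [abs_mul]; exact mul_le_one₀ hab (abs_nonneg c) hc
  have hle : 2 ≤ |d| + |a * b * c| := h ▸ abs_sub d (a * b * c)
  have h1 : |a| * |b| * |c| = 1 := by
    rw [← abs_mul, ← abs_mul]; linarith
  have hd1 : |d| = 1 := by linarith
  have hab0 : |a| * |b| ≤ 1 := by rwa [← abs_mul]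
  refine ⟨?_, ?_, ?_, hd1, ?_⟩
  · nlinarith [abs_nonneg a, abs_nonneg b, abs_nonneg c, mul_nonneg (abs_nonneg a) (abs_nonneg b)]
  · nlinarith [abs_nonneg a, abs_nonneg b, abs_nonneg c, mul_nonneg (abs_nonneg a) (abs_nonneg b)]
  · nlinarith [abs_nonneg a, abs_nonneg b, abs_nonneg c, mul_nonneg (abs_nonneg a) (abs_nonneg b)]
  · obtain ⟨h3, h4⟩ := abs_le.mp habc
    obtain ⟨h5, h6⟩ := abs_le.mp hd
    rcases eq_or_eq_neg_of_abs_eq h with h | h <;> linarith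

theorem O1_mul_O2_mul_O3 {n1 n2 : Fin 3 → ℝ} (h2 : IsUnitVec n2) :
    O1 n1 n2 * (O2 n1 n2 * O3 n1 n2) =
      (2 * dot3 n1 n2 : ℂ) • (spin n1 ⊗ₖ spin n2 ⊗ₖ spin n1) - O4 n1 n2 := by
  simp only [O1, O2, O3, O4, ← Matrix.mul_kronecker_mul]
  rw [spin_mul_self h2, Matrix.mul_one, ← Matrix.mul_assoc (spin n2) (spin n1),
    spin_mul_spin_mul_spin h2, ← Matrix.mul_assoc, spin_mul_self h2, Matrix.one_mul]
  ext ⟨⟨i, j⟩, k⟩ ⟨⟨i', j'⟩, k'⟩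
  simp [Matrix.kroneckerMap_apply]
  ring

theorem saturation_forces_orthogonal (ρ : Matrix Q3 Q3 ℂ)
    (hρ : ρ.PosSemidef) (htr : ρ.trace = 1)
    (n1 n2 : Fin 3 → ℝ) (h1 : IsUnitVec n1) (h2 : IsUnitVec n2)
    (hsat : |Ifun n1 n2 ρ| = 2) :
    dot3 n1 n2 = 0 := by
  have hbound {M : Matrix Q3 Q3 ℂ} (hM : M.IsHermitian) (hM2 : M * M = 1) :=
    abs_re_trace_mul_le_one hM hM2 hρ htr
  have heig {M : Matrix Q3 Q3 ℂ} (hM : M.IsHermitian) (hM2 : M * M = 1) :=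
    mul_eq_smul_of_abs_re_trace_eq_one hM hM2 hρ htr
  have H1 : (O1 n1 n2).IsHermitian := spin_kronecker_isHermitian ..
  have H2 : (O2 n1 n2).IsHermitian := spin_kronecker_isHermitian ..
  have H3 : (O3 n1 n2).IsHermitian := spin_kronecker_isHermitian ..
  have H4 : (O4 n1 n2).IsHermitian := spin_kronecker_isHermitian ..
  have S1 : O1 n1 n2 * O1 n1 n2 = 1 := spin_kronecker_mul_self h1 h2 h2
  have S2 : O2 n1 n2 * O2 n1 n2 = 1 := spin_kronecker_mul_self h2 h1 h2
  have S3 : O3 n1 n2 * O3 n1 n2 = 1 := spin_kronecker_mul_self h2 h2 h1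
  have S4 : O4 n1 n2 * O4 n1 n2 = 1 := spin_kronecker_mul_self h1 h1 h1
  obtain ⟨a1, a2, a3, a4, hprod⟩ := abs_eq_one_of_abs_sub_mul_eq_two (hbound H1 S1)
    (hbound H2 S2) (hbound H3 S3) (hbound H4 S4) hsat
  have E1 := heig H1 S1 a1
  have E2 := heig H2 S2 a2
  have E3 := heig H3 S3 a3
  have E4 := heig H4 S4 a4
  generalize (O1 n1 n2 * ρ).trace.re = e1 at *
  generalize (O2 n1 n2 * ρ).trace.re = e2 at *
  generalize (O3 n1 n2 * ρ).trace.re = e3 at *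
  generalize (O4 n1 n2 * ρ).trace.re = e4 at *
  have hprod' : (e3 * e2 * e1 : ℂ) = -e4 := by
    rw [← Complex.ofReal_neg, ← hprod]; push_cast; ring
  have key : O1 n1 n2 * (O2 n1 n2 * O3 n1 n2) * ρ = -((e4 : ℂ) • ρ) := by
    rw [Matrix.mul_assoc, Matrix.mul_assoc, E3, Matrix.mul_smul, E2, Matrix.mul_smul,
      Matrix.mul_smul, E1, smul_smul, smul_smul, hprod', neg_smul]
  rw [O1_mul_O2_mul_O3 h2, sub_mul, E4, sub_eq_neg_self, Matrix.smul_mul] at key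
  have hcρ := congrArg ((spin n1 ⊗ₖ spin n2 ⊗ₖ spin n1) * ·) key
  simp only [Matrix.mul_smul, ← Matrix.mul_assoc, spin_kronecker_mul_self h1 h2 h1,
    Matrix.one_mul, Matrix.mul_zero] at hcρ
  simpa [htr] using congrArg Matrix.trace hcρ
end
end

section
/- For the GHZ state ψ_GHZ = (|000⟩ + |111⟩)/√2 and the directions n1 = x̂ = (1,0,0), n2 = ŷ = (0,1,0), the four expectations are ⟨ψ_GHZ, (σx⊗σy⊗σy)ψ_GHZ⟩ = ⟨ψ_GHZ, (σy⊗σx⊗σy)ψ_GHZ⟩ = ⟨ψ_GHZ, (σy⊗σy⊗σx)ψ_GHZ⟩ = −1 and ⟨ψ_GHZ, (σx⊗σx⊗σx)ψ_GHZ⟩ = +1, so that I(x̂,ŷ;ψ_GHZψ_GHZ†) = 1 − (−1)³ = 2. -/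
open Matrix Kronecker
open scoped ComplexOrder

noncomputable section

/-- The GHZ state `(|000⟩ + |111⟩)/√2`. -/
def ψGHZ : Q3 → ℂ := ((Real.sqrt 2 : ℂ))⁻¹ • (ket 0 0 0 + ket 1 1 1)

theorem ket_eq_single (i j k : Fin 2) : ket i j k = Pi.single ((i, j), k) 1 := by
  funext p
  simp [ket, Pi.single_apply]

/-- The expectation of a product operator in the GHZ state only sees the "diagonal" products of
entries of the three factors. -/
theorem star_ψGHZ_dotProduct_kronecker_mulVec (A B C : Matrix (Fin 2) (Fin 2) ℂ) :
    star ψGHZ ⬝ᵥ (A ⊗ₖ B ⊗ₖ C).mulVec ψGHZ =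
      (∑ i, ∑ j, A i j * B i j * C i j) / 2 := by
  have h : ((Real.sqrt 2 : ℂ))⁻¹ * ((Real.sqrt 2 : ℂ))⁻¹ = 1 / 2 := by
    rw [← mul_inv, ← Complex.ofReal_mul, Real.mul_self_sqrt (by norm_num)]
    norm_num
  simp only [ψGHZ, ket_eq_single, star_smul, star_add, Pi.star_single, star_one,
    mulVec_smul, mulVec_add, mulVec_single_one, smul_dotProduct, dotProduct_smul, add_dotProduct,
    dotProduct_add, single_one_dotProduct, col_apply, kroneckerMap_apply, Fin.sum_univ_two,
    smul_eq_mul, star_inv₀, RCLike.star_def, Complex.conj_ofReal]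
  linear_combination (A 0 0 * B 0 0 * C 0 0 + A 0 1 * B 0 1 * C 0 1 + A 1 0 * B 1 0 * C 1 0 +
    A 1 1 * B 1 1 * C 1 1) * h

theorem spin_x : spin ![1, 0, 0] = σx := by simp [spin]

theorem spin_y : spin ![0, 1, 0] = σy := by simp [spin]

theorem GHZ_correlators_and_I :
    star ψGHZ ⬝ᵥ (σx ⊗ₖ σy ⊗ₖ σy).mulVec ψGHZ = -1 ∧
    star ψGHZ ⬝ᵥ (σy ⊗ₖ σx ⊗ₖ σy).mulVec ψGHZ = -1 ∧
    star ψGHZ ⬝ᵥ (σy ⊗ₖ σy ⊗ₖ σx).mulVec ψGHZ = -1 ∧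
    star ψGHZ ⬝ᵥ (σx ⊗ₖ σx ⊗ₖ σx).mulVec ψGHZ = 1 ∧
    Ipure ![1, 0, 0] ![0, 1, 0] ψGHZ = 1 - (-1) ^ 3 ∧
    Ipure ![1, 0, 0] ![0, 1, 0] ψGHZ = 2 := by
  have hxyy : star ψGHZ ⬝ᵥ (σx ⊗ₖ σy ⊗ₖ σy).mulVec ψGHZ = -1 := by
    rw [star_ψGHZ_dotProduct_kronecker_mulVec]
    norm_num [σx, σy]
  have hyxy : star ψGHZ ⬝ᵥ (σy ⊗ₖ σx ⊗ₖ σy).mulVec ψGHZ = -1 := by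
    rw [star_ψGHZ_dotProduct_kronecker_mulVec]
    norm_num [σx, σy]
  have hyyx : star ψGHZ ⬝ᵥ (σy ⊗ₖ σy ⊗ₖ σx).mulVec ψGHZ = -1 := by
    rw [star_ψGHZ_dotProduct_kronecker_mulVec]
    norm_num [σx, σy]
  have hxxx : star ψGHZ ⬝ᵥ (σx ⊗ₖ σx ⊗ₖ σx).mulVec ψGHZ = 1 := by
    rw [star_ψGHZ_dotProduct_kronecker_mulVec]
    norm_num [σx]
  have hI : Ipure ![1, 0, 0] ![0, 1, 0] ψGHZ = 2 := by
    simp only [Ipure, eexp, O1, O2, O3, O4, spin_x, spin_y, hxyy, hyxy, hyyx, hxxx]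
    norm_num
  exact ⟨hxyy, hyxy, hyyx, hxxx, by rw [hI]; norm_num, hI⟩
end
end

section
/- For unit vectors n1, n2 ∈ ℝ³ with c = n1·n2 and m = n1×n2 (the cross product), the commutator of O1 = σ_{n1}⊗σ_{n2}⊗σ_{n2} and O2 = σ_{n2}⊗σ_{n1}⊗σ_{n2} is [O1,O2] = 2ic·((m·σ)⊗I₂ − I₂⊗(m·σ))⊗I₂, where m·σ = m₁·σx + m₂·σy + m₃·σz and I₂ is the 2×2 identity matrix. -/
open Matrix Kronecker
open scoped ComplexOrder

noncomputable section

/-- Cross product of two vectors in `ℝ³`. -/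
def cross3 (a b : Fin 3 → ℝ) : Fin 3 → ℝ :=
  ![a 1 * b 2 - a 2 * b 1, a 2 * b 0 - a 0 * b 2, a 0 * b 1 - a 1 * b 0]

theorem spin_mul_spin (a b : Fin 3 → ℝ) :
    spin a * spin b = (dot3 a b : ℂ) • 1 + Complex.I • spin (cross3 a b) := by
  ext i j
  fin_cases i <;> fin_cases j <;>
    simp [spin, σx, σy, σz, dot3, cross3, Matrix.mul_apply, Fin.sum_univ_two] <;>
    ring_nf <;> simp only [Complex.I_sq] <;> ring

theorem dot3_comm (a b : Fin 3 → ℝ) : dot3 a b = dot3 b a := by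
  simp only [dot3]; ring

theorem spin_cross3_swap (a b : Fin 3 → ℝ) : spin (cross3 b a) = -spin (cross3 a b) := by
  have h : cross3 b a = -cross3 a b := by
    ext i
    fin_cases i <;> simp [cross3] <;> ring
  simp only [h, spin, Pi.neg_apply, Complex.ofReal_neg, neg_smul]
  abel

theorem spin_mul_self_of_isUnitVec {n : Fin 3 → ℝ} (h : IsUnitVec n) : spin n * spin n = 1 := by
  have hd : dot3 n n = 1 := by
    rw [← h, dot3]; ring
  have hc : spin (cross3 n n) = 0 := by
    simp [spin, cross3, mul_comm]
  rw [spin_mul_spin, hd, hc]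
  simp

theorem commutator_O1_O2 (n1 n2 : Fin 3 → ℝ) (h1 : IsUnitVec n1) (h2 : IsUnitVec n2) :
    O1 n1 n2 * O2 n1 n2 - O2 n1 n2 * O1 n1 n2 =
      (2 * Complex.I * (dot3 n1 n2 : ℂ)) •
        ((spin (cross3 n1 n2) ⊗ₖ (1 : Matrix (Fin 2) (Fin 2) ℂ) -
          (1 : Matrix (Fin 2) (Fin 2) ℂ) ⊗ₖ spin (cross3 n1 n2)) ⊗ₖ
            (1 : Matrix (Fin 2) (Fin 2) ℂ)) := by
  rw [O1, O2]
  simp only [← mul_kronecker_mul, spin_mul_self_of_isUnitVec h2]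
  rw [spin_mul_spin n1 n2, spin_mul_spin n2 n1, dot3_comm n2 n1, spin_cross3_swap n1 n2]
  ext ⟨⟨i, j⟩, k⟩ ⟨⟨i', j'⟩, k'⟩
  simp only [Matrix.sub_apply, Matrix.add_apply, Matrix.smul_apply, Matrix.neg_apply,
    kroneckerMap_apply, smul_eq_mul]
  ring
end
end

section
/- If n1, n2 ∈ ℝ³ are orthogonal unit vectors (n1·n2 = 0), then the operators O1 = σ_{n1}⊗σ_{n2}⊗σ_{n2}, O2 = σ_{n2}⊗σ_{n1}⊗σ_{n2}, O3 = σ_{n2}⊗σ_{n2}⊗σ_{n1}, O4 = σ_{n1}⊗σ_{n1}⊗σ_{n1} satisfy the stabiliser relation O1·O2·O3·O4 = −1 (minus the 8×8 identity matrix). -/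
open Matrix Kronecker
open scoped ComplexOrder

noncomputable section

/-- The Clifford relation for spin observables. -/
theorem spin_mul_add_spin_mul (a b : Fin 3 → ℝ) :
    spin a * spin b + spin b * spin a = (2 * dot3 a b : ℂ) • (1 : Matrix (Fin 2) (Fin 2) ℂ) := by
  ext i j
  fin_cases i <;> fin_cases j <;>
    simp [spin, σx, σy, σz, dot3] <;>
    ring_nf <;> simp only [Complex.I_sq] <;> ring

theorem spin_mul_spin_of_dot3_eq_zero {a b : Fin 3 → ℝ} (hab : dot3 a b = 0) :
    spin b * spin a = -(spin a * spin b) := by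
  have h := spin_mul_add_spin_mul a b
  rw [hab, Complex.ofReal_zero, mul_zero, zero_smul] at h
  exact eq_neg_of_add_eq_zero_right h

theorem GHZ_stabiliser_relation (n1 n2 : Fin 3 → ℝ) (h1 : IsUnitVec n1) (h2 : IsUnitVec n2)
    (horth : dot3 n1 n2 = 0) :
    O1 n1 n2 * O2 n1 n2 * O3 n1 n2 * O4 n1 n2 = -(1 : Matrix Q3 Q3 ℂ) := by
  have hs1 := spin_mul_self h1
  have hs2 := spin_mul_self h2
  have first : spin n1 * spin n2 * spin n2 * spin n1 = 1 := by
    rw [mul_assoc (spin n1), hs2, mul_one, hs1]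
  have second : spin n2 * spin n1 * spin n2 * spin n1 = -1 := by
    rw [mul_assoc _ (spin n2)]
    nth_rw 1 [spin_mul_spin_of_dot3_eq_zero horth]
    rw [neg_mul, ← mul_assoc, first]
  have third : spin n2 * spin n2 * spin n1 * spin n1 = 1 := by
    rw [hs2, one_mul, hs1]
  simp only [O1, O2, O3, O4, ← mul_kronecker_mul, first, second, third]
  rw [← neg_one_smul ℂ (1 : Matrix (Fin 2) (Fin 2) ℂ), kronecker_smul, smul_kronecker,
    one_kronecker_one, one_kronecker_one, neg_one_smul]
end
end

section
/- For every state in the Acín canonical form ψ = λ0|000⟩ + λ1·e^{iφ}|100⟩ + λ2|101⟩ + λ3|110⟩ + λ4|111⟩ with λ0,…,λ4 ≥ 0, λ0² + λ1² + λ2² + λ3² + λ4² = 1 and φ ∈ ℝ, one has ⟨ψ, (σx⊗σy⊗σy)ψ⟩ = ⟨ψ, (σy⊗σx⊗σy)ψ⟩ = ⟨ψ, (σy⊗σy⊗σx)ψ⟩ = −2·λ0·λ4, independently of λ1, λ2, λ3 and φ. -/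
open Matrix Kronecker
open scoped ComplexOrder

noncomputable section

/-- A three-qubit pure state in the Acín canonical form. -/
def acin (l0 l1 l2 l3 l4 φ : ℝ) : Q3 → ℂ :=
  (l0 : ℂ) • ket 0 0 0 + ((l1 : ℂ) * Complex.exp (Complex.I * φ)) • ket 1 0 0 +
    (l2 : ℂ) • ket 1 0 1 + (l3 : ℂ) • ket 1 1 0 + (l4 : ℂ) • ket 1 1 1

theorem acin_xyy (l0 l1 l2 l3 l4 φ : ℝ)
    (h0 : 0 ≤ l0) (h1 : 0 ≤ l1) (h2 : 0 ≤ l2) (h3 : 0 ≤ l3) (h4 : 0 ≤ l4)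
    (hnorm : l0 ^ 2 + l1 ^ 2 + l2 ^ 2 + l3 ^ 2 + l4 ^ 2 = 1) :
    star (acin l0 l1 l2 l3 l4 φ) ⬝ᵥ (σx ⊗ₖ σy ⊗ₖ σy).mulVec (acin l0 l1 l2 l3 l4 φ) =
      (-(2 * l0 * l4) : ℝ) ∧
    star (acin l0 l1 l2 l3 l4 φ) ⬝ᵥ (σy ⊗ₖ σx ⊗ₖ σy).mulVec (acin l0 l1 l2 l3 l4 φ) =
      (-(2 * l0 * l4) : ℝ) ∧
    star (acin l0 l1 l2 l3 l4 φ) ⬝ᵥ (σy ⊗ₖ σy ⊗ₖ σx).mulVec (acin l0 l1 l2 l3 l4 φ) =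
      (-(2 * l0 * l4) : ℝ) := by
  refine ⟨?_, ?_, ?_⟩ <;>
  · simp [acin, ket, σx, σy, dotProduct, Matrix.mulVec, Fintype.sum_prod_type, kroneckerMap_apply]
    ring
end
end

section
/- For the W state ψ_W = (|001⟩ + |010⟩ + |100⟩)/√3 and the directions n1 = ẑ = (0,0,1), n2 = x̂ = (1,0,0), the functional takes the value I(ẑ,x̂;ψ_Wψ_W†) = −1 − (2/3)³ = −35/27, while for n1 = x̂, n2 = ŷ it vanishes: I(x̂,ŷ;ψ_Wψ_W†) = 0. -/
open Matrix Kronecker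
open scoped ComplexOrder

noncomputable section

/-- The W state `(|001⟩ + |010⟩ + |100⟩)/√3`. -/
def ψW : Q3 → ℂ := ((Real.sqrt 3 : ℂ))⁻¹ • (ket 0 0 1 + ket 0 1 0 + ket 1 0 0)

/-- The components of the W state. -/
lemma ψW_apply (i j k : Fin 2) :
    ψW ((i, j), k) =
      ((Real.sqrt 3 : ℂ))⁻¹ * (ket 0 0 1 + ket 0 1 0 + ket 1 0 0) ((i, j), k) := rfl

/-- The expectation value of a product observable in the W state. -/
lemma eexp_kronecker_ψW (A B C : Matrix (Fin 2) (Fin 2) ℂ) :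
    eexp (A ⊗ₖ B ⊗ₖ C) ψW =
      (A 0 0 * B 0 0 * C 1 1 + A 0 0 * B 1 1 * C 0 0 + A 1 1 * B 0 0 * C 0 0 +
        A 0 0 * B 0 1 * C 1 0 + A 0 0 * B 1 0 * C 0 1 + A 0 1 * B 0 0 * C 1 0 +
        A 1 0 * B 0 0 * C 0 1 + A 0 1 * B 1 0 * C 0 0 + A 1 0 * B 0 1 * C 0 0).re / 3 := by
  have hsqrt : ((Real.sqrt 3 : ℂ))⁻¹ * ((Real.sqrt 3 : ℂ))⁻¹ = ((1 / 3 : ℝ) : ℂ) := by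
    rw [← mul_inv, ← Complex.ofReal_mul, Real.mul_self_sqrt (by norm_num)]
    norm_num
  rw [div_eq_inv_mul, ← one_div, ← Complex.re_ofReal_mul, ← hsqrt, eexp]
  congr 1
  simp [dotProduct, mulVec, Fintype.sum_prod_type, ψW_apply, ket]
  ring

theorem W_I_values :
    Ipure ![0, 0, 1] ![1, 0, 0] ψW = -1 - (2 / 3) ^ 3 ∧
    Ipure ![0, 0, 1] ![1, 0, 0] ψW = -(35 / 27) ∧
    Ipure ![1, 0, 0] ![0, 1, 0] ψW = 0 := by
  have hz : spin ![0, 0, 1] = σz := by simp [spin]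
  have hx : spin ![1, 0, 0] = σx := by simp [spin]
  have hy : spin ![0, 1, 0] = σy := by simp [spin]
  have hzx : Ipure ![0, 0, 1] ![1, 0, 0] ψW = -(35 / 27) := by
    simp [Ipure, O1, O2, O3, O4, eexp_kronecker_ψW, hz, hx, σx, σz]
    norm_num
  refine ⟨by rw [hzx]; norm_num, hzx, ?_⟩
  simp [Ipure, O1, O2, O3, O4, eexp_kronecker_ψW, hx, hy, σx, σy]
end
end

section
/- Let n1, n2 ∈ ℝ³ be orthogonal unit vectors (n1·n2 = 0) with third components a₃ = (n1)₃ and b₃ = (n2)₃. Then for the W state ψ_W = (|001⟩ + |010⟩ + |100⟩)/√3, the functional has the explicit form I(n1,n2;ψ_Wψ_W†) = a₃·(2 − 3a₃²) − a₃³·(2/3 − 3b₃²)³. -/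
open Matrix Kronecker
open scoped ComplexOrder

noncomputable section

/-- Three-body spin correlation of the W state along arbitrary directions. -/
theorem eexp_spin_kronecker_ψW (a b c : Fin 3 → ℝ) :
    eexp (spin a ⊗ₖ spin b ⊗ₖ spin c) ψW =
      -(a 2 * b 2 * c 2) + 2 / 3 * ((a 0 * b 0 + a 1 * b 1) * c 2 +
        (a 0 * c 0 + a 1 * c 1) * b 2 + (b 0 * c 0 + b 1 * c 1) * a 2) := by
  have hs : (√3)⁻¹ * (√3)⁻¹ = (1 / 3 : ℝ) := by
    rw [← mul_inv, Real.mul_self_sqrt (by norm_num)]; norm_num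
  simp [eexp, ψW, ket, spin, σx, σy, σz, dotProduct, mulVec, Fintype.sum_prod_type,
    ← Complex.ofReal_inv]
  linear_combination (-3 * (a 2 * b 2 * c 2) + 2 * ((a 0 * b 0 + a 1 * b 1) * c 2 +
    (a 0 * c 0 + a 1 * c 1) * b 2 + (b 0 * c 0 + b 1 * c 1) * a 2)) * hs

theorem W_I_explicit_form (n1 n2 : Fin 3 → ℝ) (h1 : IsUnitVec n1) (h2 : IsUnitVec n2)
    (horth : dot3 n1 n2 = 0) :
    Ipure n1 n2 ψW =
      n1 2 * (2 - 3 * (n1 2) ^ 2) - (n1 2) ^ 3 * (2 / 3 - 3 * (n2 2) ^ 2) ^ 3 := by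
  unfold IsUnitVec at h1 h2
  unfold dot3 at horth
  have e4 : eexp (O4 n1 n2) ψW = n1 2 * (2 - 3 * n1 2 ^ 2) := by
    rw [O4, eexp_spin_kronecker_ψW]
    linear_combination 2 * n1 2 * h1
  have e1 : eexp (O1 n1 n2) ψW = n1 2 * (2 / 3 - 3 * n2 2 ^ 2) := by
    rw [O1, eexp_spin_kronecker_ψW]
    linear_combination 2 / 3 * n1 2 * h2 + 4 / 3 * n2 2 * horth
  have e2 : eexp (O2 n1 n2) ψW = n1 2 * (2 / 3 - 3 * n2 2 ^ 2) := by
    rw [O2, eexp_spin_kronecker_ψW]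
    linear_combination 2 / 3 * n1 2 * h2 + 4 / 3 * n2 2 * horth
  have e3 : eexp (O3 n1 n2) ψW = n1 2 * (2 / 3 - 3 * n2 2 ^ 2) := by
    rw [O3, eexp_spin_kronecker_ψW]
    linear_combination 2 / 3 * n1 2 * h2 + 4 / 3 * n2 2 * horth
  rw [Ipure, e1, e2, e3, e4]
  ring
end
end

section
/- For all real numbers u, v with u² + v² ≤ 1 and u, v ∈ [−1,1], the function f(u,v) = u·(2 − 3u²) − u³·(2/3 − 3v²)³ satisfies |f(u,v)| ≤ 35/27, with equality attained at (u,v) = (±1, 0). Consequently, for every pair of orthogonal unit vectors n1, n2 ∈ ℝ³, the W state satisfies |I(n1,n2;ψ_Wψ_W†)| ≤ 35/27, with equality for n1 = ẑ = (0,0,1) and n2 = x̂ = (1,0,0). -/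
open Matrix Kronecker
open scoped ComplexOrder

noncomputable section

theorem eexp_kronecker_spin_W (a b c : Fin 3 → ℝ) :
    eexp (spin a ⊗ₖ spin b ⊗ₖ spin c) ψW =
      -(a 2 * b 2 * c 2) + 2 / 3 * (a 2 * (b 0 * c 0 + b 1 * c 1) +
        b 2 * (a 0 * c 0 + a 1 * c 1) + c 2 * (a 0 * b 0 + a 1 * b 1)) := by
  have h3 : (Real.sqrt 3)⁻¹ * (Real.sqrt 3)⁻¹ = 1 / 3 := by
    rw [← mul_inv, Real.mul_self_sqrt (by norm_num)]; norm_num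
  have hψ : ψW = ((((Real.sqrt 3)⁻¹ : ℝ) : ℂ)) • (ket 0 0 1 + ket 0 1 0 + ket 1 0 0) := by
    simp [ψW]
  rw [hψ]
  generalize (Real.sqrt 3)⁻¹ = r at h3
  simp [eexp, dotProduct, mulVec, Fintype.sum_prod_type, Fin.sum_univ_two, ket, spin, σx, σy, σz,
    kroneckerMap_apply]
  linear_combination (3 * (-(a 2 * b 2 * c 2)) + 2 * (a 2 * (b 0 * c 0 + b 1 * c 1) +
        b 2 * (a 0 * c 0 + a 1 * c 1) + c 2 * (a 0 * b 0 + a 1 * b 1))) * h3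

theorem Ipure_W {n1 n2 : Fin 3 → ℝ} (h1 : IsUnitVec n1) (h2 : IsUnitVec n2)
    (h : dot3 n1 n2 = 0) :
    Ipure n1 n2 ψW =
      n1 2 * (2 - 3 * n1 2 ^ 2) - n1 2 ^ 3 * (2 / 3 - 3 * n2 2 ^ 2) ^ 3 := by
  simp only [IsUnitVec] at h1 h2
  simp only [dot3] at h
  have e4 : eexp (O4 n1 n2) ψW = n1 2 * (2 - 3 * n1 2 ^ 2) := by
    rw [O4, eexp_kronecker_spin_W]
    linear_combination 2 * n1 2 * h1
  have e1 : eexp (O1 n1 n2) ψW = n1 2 * (2 / 3 - 3 * n2 2 ^ 2) := by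
    rw [O1, eexp_kronecker_spin_W]
    linear_combination 2 / 3 * n1 2 * h2 + 4 / 3 * n2 2 * h
  have e2 : eexp (O2 n1 n2) ψW = n1 2 * (2 / 3 - 3 * n2 2 ^ 2) := by
    rw [O2, eexp_kronecker_spin_W]
    linear_combination 2 / 3 * n1 2 * h2 + 4 / 3 * n2 2 * h
  have e3 : eexp (O3 n1 n2) ψW = n1 2 * (2 / 3 - 3 * n2 2 ^ 2) := by
    rw [O3, eexp_kronecker_spin_W]
    linear_combination 2 / 3 * n1 2 * h2 + 4 / 3 * n2 2 * h
  rw [Ipure, e4, e1, e2, e3]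
  ring

theorem abs_W_poly_le_of_nonneg {u v : ℝ} (h : u ^ 2 + v ^ 2 ≤ 1) (hu : 0 ≤ u) :
    |u * (2 - 3 * u ^ 2) - u ^ 3 * (2 / 3 - 3 * v ^ 2) ^ 3| ≤ 35 / 27 := by
  have hu1 : u ≤ 1 := by nlinarith [sq_nonneg v]
  rw [← mul_pow, abs_le]
  constructor
  · have hle : u * (2 / 3 - 3 * v ^ 2) ≤ u * (2 / 3) := by
      gcongr
      nlinarith [sq_nonneg v]
    have hcube := (Odd.strictMono_pow (R := ℝ) (n := 3) (by decide)).monotone hle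
    nlinarith [mul_nonneg hu (sub_nonneg.2 hu1),
      mul_nonneg (mul_nonneg hu hu) (sub_nonneg.2 hu1)]
  · have ht : -(4 / 5) ≤ u * (2 / 3 - 3 * v ^ 2) := by
      have hw : u * (3 * u ^ 2 - 7 / 3) ≤ u * (2 / 3 - 3 * v ^ 2) :=
        mul_le_mul_of_nonneg_left (by linarith) hu
      nlinarith [mul_nonneg hu (sq_nonneg (u - 1 / 2)), sq_nonneg (u - 1 / 2)]
    have hcube := (Odd.strictMono_pow (R := ℝ) (n := 3) (by decide)).monotone ht
    nlinarith [mul_nonneg hu (sq_nonneg (u - 1 / 2)), sq_nonneg (u - 1 / 2)]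

theorem abs_W_poly_le {u v : ℝ} (h : u ^ 2 + v ^ 2 ≤ 1) :
    |u * (2 - 3 * u ^ 2) - u ^ 3 * (2 / 3 - 3 * v ^ 2) ^ 3| ≤ 35 / 27 := by
  rcases le_total 0 u with hu | hu
  · exact abs_W_poly_le_of_nonneg h hu
  · have key := abs_W_poly_le_of_nonneg (u := -u) (v := v) (by simpa using h) (by linarith)
    rw [← abs_neg]
    convert key using 2
    ring

/-- Bessel's inequality for the third basis vector. -/
theorem sq_add_sq_le_one_of_orthonormal {n1 n2 : Fin 3 → ℝ} (h1 : IsUnitVec n1)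
    (h2 : IsUnitVec n2) (h : dot3 n1 n2 = 0) : n1 2 ^ 2 + n2 2 ^ 2 ≤ 1 := by
  simp only [IsUnitVec] at h1 h2
  simp only [dot3] at h
  set a := n1 2
  set b := n2 2
  have hr : (a * n1 0 + b * n2 0) ^ 2 + (a * n1 1 + b * n2 1) ^ 2 + (a * a + b * b - 1) ^ 2
      = 1 - (a ^ 2 + b ^ 2) := by
    linear_combination a ^ 2 * h1 + b ^ 2 * h2 + 2 * a * b * h
  nlinarith [sq_nonneg (a * n1 0 + b * n2 0), sq_nonneg (a * n1 1 + b * n2 1),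
    sq_nonneg (a * a + b * b - 1)]

theorem W_I_max :
    (∀ u v : ℝ, u ^ 2 + v ^ 2 ≤ 1 → -1 ≤ u → u ≤ 1 → -1 ≤ v → v ≤ 1 →
      |u * (2 - 3 * u ^ 2) - u ^ 3 * (2 / 3 - 3 * v ^ 2) ^ 3| ≤ 35 / 27) ∧
    |(1 : ℝ) * (2 - 3 * (1 : ℝ) ^ 2) - (1 : ℝ) ^ 3 * (2 / 3 - 3 * (0 : ℝ) ^ 2) ^ 3| = 35 / 27 ∧
    |(-1 : ℝ) * (2 - 3 * (-1 : ℝ) ^ 2) - (-1 : ℝ) ^ 3 * (2 / 3 - 3 * (0 : ℝ) ^ 2) ^ 3| = 35 / 27 ∧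
    (∀ n1 n2 : Fin 3 → ℝ, IsUnitVec n1 → IsUnitVec n2 → dot3 n1 n2 = 0 →
      |Ipure n1 n2 ψW| ≤ 35 / 27) ∧
    |Ipure ![0, 0, 1] ![1, 0, 0] ψW| = 35 / 27 := by
  refine ⟨fun u v h _ _ _ _ => abs_W_poly_le h, ?_, ?_, fun n1 n2 h1 h2 h => ?_, ?_⟩
  · norm_num [abs_of_neg]
  · norm_num [abs_of_pos]
  · rw [Ipure_W h1 h2 h]
    exact abs_W_poly_le (sq_add_sq_le_one_of_orthonormal h1 h2 h)
  · rw [Ipure_W (by simp [IsUnitVec]) (by simp [IsUnitVec]) (by simp [dot3])]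
    simp only [cons_val]
    norm_num [abs_of_neg]
end
end
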